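/- Let X = Y = ℂ⁴ and let ρ_k = |φ_k⟩⟨φ_k| for k = 1, 2, 3, 4 be the Yu–Duan–Ying states. For every separable measurement {P_1, P_2, P_3, P_4} on X : Y, the success probability of discriminating ρ_1, ρ_2, ρ_3, ρ_4 with uniform prior 1/4 satisfies (1/4) Σ_{k=1}^{4} Tr(ρ_k P_k) ≤ 3/4. -/

import Mathlib

open Matrix Complex
open scoped Matrix Kronecker ComplexOrder

noncomputable section

/-- The tensor (Kronecker) product of two vectors. -/
def tens {α β : Type*} (u : α → ℂ) (v : β → ℂ) : α × β → ℂ := fun p => u p.1 * v p.2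

/-- The rank-one operator `u u*`. -/
def proj {α : Type*} (u : α → ℂ) : Matrix α α ℂ := Matrix.vecMulVec u (star u)

/-- A separable (positive semidefinite) operator with respect to the bipartition `α : β`. -/
def SepMat {α β : Type*} [Fintype α] [Fintype β] (P : Matrix (α × β) (α × β) ℂ) : Prop :=
  ∃ (M : ℕ) (Q : Fin M → Matrix α α ℂ) (R : Fin M → Matrix β β ℂ),
    (∀ j, (Q j).PosSemidef) ∧ (∀ j, (R j).PosSemidef) ∧ P = ∑ j, Q j ⊗ₖ R j

/-- The operator `(1 ⊗ y)* H (1 ⊗ y)` on the first factor. -/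
def blockCompress {α β : Type*} [Fintype β] (H : Matrix (α × β) (α × β) ℂ) (y : β → ℂ) :
    Matrix α α ℂ :=
  Matrix.of fun i j => ∑ a, ∑ b, star (y a) * H (i, a) (j, b) * y b

/-- Block positivity with respect to the bipartition `α : β`. -/
def BlockPositive {α β : Type*} [Fintype α] [Fintype β] (H : Matrix (α × β) (α × β) ℂ) : Prop :=
  ∀ y : β → ℂ, (blockCompress H y).PosSemidef

/-- Partial transposition on the first tensor factor. -/
def ptFst {α β : Type*} (M : Matrix (α × β) (α × β) ℂ) : Matrix (α × β) (α × β) ℂ :=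
  Matrix.of fun r c => M (c.1, r.2) (r.1, c.2)

/-- The Yu–Duan–Ying states in `ℂ⁴ ⊗ ℂ⁴`. -/
def ydyVec : Fin 4 → (Fin 4 × Fin 4) → ℂ :=
  ![fun p => if p.1 = p.2 then 1 / 2 else 0,
    fun p => if (p.1 : ℕ) + (p.2 : ℕ) = 3 then 1 / 2 else 0,
    fun p => if p = (0, 3) ∨ p = (1, 2) then 1 / 2
             else if p = (2, 1) ∨ p = (3, 0) then -(1 / 2) else 0,
    fun p => if p = (0, 1) ∨ p = (1, 0) then 1 / 2
             else if p = (2, 3) ∨ p = (3, 2) then -(1 / 2) else 0]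


lemma aux_bessel (a w w' : Fin 4 → ℂ) (N : ℝ) (hw : ∑ i, normSq (w i) = N)
    (hw' : ∑ i, normSq (w' i) = N) (h : ∑ i, w i * star (w' i) = 0) :
    normSq (∑ i, a i * w i) + normSq (∑ i, a i * w' i) ≤ (∑ i, normSq (a i)) * N := by
  have hN : 0 ≤ N := hw ▸ Finset.sum_nonneg fun i _ => normSq_nonneg _
  rcases hN.eq_or_lt with h0 | hpos
  · subst h0
    have e1 : ∀ i, w i = 0 := fun i => by
      have := (Finset.sum_eq_zero_iff_of_nonneg fun i _ => normSq_nonneg (w i)).1 hw i (by simp)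
      simpa using this
    have e2 : ∀ i, w' i = 0 := fun i => by
      have := (Finset.sum_eq_zero_iff_of_nonneg fun i _ => normSq_nonneg (w' i)).1 hw' i (by simp)
      simpa using this
    simp [e1, e2]
  · set p := ∑ i, a i * w i with hp
    set q := ∑ i, a i * w' i with hq
    have key : ((∑ i, normSq ((N : ℂ) * a i - p * star (w i) - q * star (w' i)) : ℝ) : ℂ)
        = ((N * ((∑ i, normSq (a i)) * N - normSq p - normSq q) : ℝ) : ℂ) := by
      have h' : ∑ i, w' i * star (w i) = 0 := by
        have := congrArg star h
        simpa [mul_comm] using this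
      have hwc : ∑ i, w i * star (w i) = (N : ℂ) := by
        rw [← hw]; push_cast; simp [mul_conj]
      have hwc' : ∑ i, w' i * star (w' i) = (N : ℂ) := by
        rw [← hw']; push_cast; simp [mul_conj]
      have hps : star p = ∑ i, star (a i) * star (w i) := by simp [hp]
      have hqs : star q = ∑ i, star (a i) * star (w' i) := by simp [hq]
      have hNs : star (N : ℂ) = N := by simp
      have e : ∀ z : ℂ, ((normSq z : ℝ) : ℂ) = z * star z := fun z => by
        simp [mul_conj]
      push_cast
      simp only [e, star_sub, star_mul', star_star, hNs]
      have : ∀ i, ((N : ℂ) * a i - p * star (w i) - q * star (w' i)) *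
          (N * star (a i) - star p * w i - star q * w' i)
          = N * N * (a i * star (a i)) - N * star p * (a i * w i) - N * star q * (a i * w' i)
            - N * p * (star (a i) * star (w i)) + p * star p * (w i * star (w i))
            + p * star q * (w' i * star (w i))
            - N * q * (star (a i) * star (w' i)) + q * star p * (w i * star (w' i))
            + q * star q * (w' i * star (w' i)) := fun i => by ring
      simp only [this, Finset.sum_add_distrib, Finset.sum_sub_distrib, ← Finset.mul_sum]
      rw [← hp, ← hq, ← hps, ← hqs, h, h', hwc, hwc']
      ring
    have key := Complex.ofReal_injective key
    have : 0 ≤ N * ((∑ i, normSq (a i)) * N - normSq p - normSq q) :=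
      key ▸ Finset.sum_nonneg fun i _ => normSq_nonneg _
    have := nonneg_of_mul_nonneg_right this hpos
    linarith

/-- The antisymmetric vector used for the dual certificate. -/
def auxPsi : Fin 4 × Fin 4 → ℂ := fun p =>
  if p = (0, 2) ∨ p = (3, 1) then 1 / 2 else if p = (1, 3) ∨ p = (2, 0) then -(1 / 2) else 0

lemma aux_trace {α : Type*} [Fintype α] (u v : α → ℂ) :
    ((proj u * proj v).trace).re = normSq (∑ p, star (u p) * v p) := by
  unfold proj
  rw [vecMulVec_mul_vecMulVec, trace_vecMulVec, dotProduct_smul]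
  have : (star u ⬝ᵥ v) • (u ⬝ᵥ star v) = ((normSq (∑ p, star (u p) * v p) : ℝ) : ℂ) := by
    rw [← mul_conj]
    simp [dotProduct, mul_comm]
  rw [this, ofReal_re]

lemma aux_pt (u : Fin 4 × Fin 4 → ℂ) (x y : Fin 4 → ℂ) :
    (ptFst (proj u) * proj (tens x y)).trace = (proj u * proj (tens (star x) y)).trace := by
  simp only [trace, diag, mul_apply, Fintype.sum_prod_type, ptFst, proj, tens, vecMulVec_apply,
    of_apply, Pi.star_apply, star_mul', star_star]
  have e : ∀ f : Fin 4 → Fin 4 → Fin 4 → Fin 4 → ℂ,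
      ∑ a, ∑ b, ∑ c, ∑ d, f a b c d = ∑ a, ∑ b, ∑ c, ∑ d, f c b a d := fun f => by
    calc _ = ∑ a, ∑ c, ∑ b, ∑ d, f a b c d := by
          refine Finset.sum_congr rfl fun a _ => Finset.sum_comm
      _ = ∑ c, ∑ a, ∑ b, ∑ d, f a b c d := Finset.sum_comm
      _ = _ := Finset.sum_congr rfl fun a _ => Finset.sum_comm
  rw [e]
  refine Finset.sum_congr rfl fun a _ => Finset.sum_congr rfl fun b _ =>
    Finset.sum_congr rfl fun c _ => Finset.sum_congr rfl fun d _ => ?_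
  ring

lemma aux_core (k : Fin 4) (x y : Fin 4 → ℂ) :
    ((proj (ydyVec k) * proj (tens x y)).trace).re
      + ((ptFst (proj auxPsi) * proj (tens x y)).trace).re
      ≤ 1 / 4 * ((proj (tens x y)).trace).re := by
  have ht : ((proj (tens x y)).trace).re = (∑ i, normSq (x i)) * ∑ i, normSq (y i) := by
    rw [proj, trace_vecMulVec]
    have : tens x y ⬝ᵥ star (tens x y)
        = (((∑ i, normSq (x i)) * ∑ i, normSq (y i) : ℝ) : ℂ) := by
      push_cast
      simp only [← mul_conj, dotProduct, Fintype.sum_prod_type, tens, Finset.sum_mul_sum,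
        Pi.star_apply, star_mul', starRingEnd_apply]
      refine Finset.sum_congr rfl fun a _ => Finset.sum_congr rfl fun b _ => ?_
      ring
    rw [this, ofReal_re]
  have hpsi : normSq (∑ p, star (auxPsi p) * tens (star x) y p)
      = 1 / 4 * normSq (∑ i, x i * (![star (y 2), -star (y 3), -star (y 0), star (y 1)]
          : Fin 4 → ℂ) i) := by
    rw [← normSq_conj]
    have : (1 / 4 : ℝ) = normSq (1 / 2) := by norm_num [normSq_apply]
    rw [this, ← normSq_mul]
    congr 1
    simp [auxPsi, tens, Fintype.sum_prod_type, Fin.sum_univ_four, Prod.ext_iff]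
    ring
  have main : ∀ w : Fin 4 → ℂ, (∑ i, normSq (w i) = ∑ i, normSq (y i)) →
      (∑ i, w i * star ((![star (y 2), -star (y 3), -star (y 0), star (y 1)]
          : Fin 4 → ℂ) i) = 0) →
      (∑ p, star (ydyVec k p) * tens x y p = 1 / 2 * ∑ i, x i * w i) →
      normSq (∑ p, star (ydyVec k p) * tens x y p)
        + normSq (∑ p, star (auxPsi p) * tens (star x) y p)
        ≤ 1 / 4 * ((∑ i, normSq (x i)) * ∑ i, normSq (y i)) := by
    intro w h1 h2 h3
    have := aux_bessel x w _ _ h1 (by simp [Fin.sum_univ_four]; ring) h2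
    rw [hpsi, h3, normSq_mul]
    have h4 : normSq (1 / 2) = (1 / 4 : ℝ) := by norm_num [normSq_apply]
    rw [h4]
    linarith
  have h2c : (starRingEnd ℂ) 2 = 2 := Complex.conj_ofNat 2
  rw [aux_pt, aux_trace, aux_trace, ht]
  fin_cases k
  · refine main ![y 0, y 1, y 2, y 3] ?_ ?_ ?_
    · simp [Fin.sum_univ_four]
    · simp [Fin.sum_univ_four]; ring
    · simp [h2c, ydyVec, tens, Fintype.sum_prod_type, Fin.sum_univ_four]; ring
  · refine main ![y 3, y 2, y 1, y 0] ?_ ?_ ?_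
    · simp [Fin.sum_univ_four]; ring
    · simp [Fin.sum_univ_four]; ring
    · simp [h2c, ydyVec, tens, Fintype.sum_prod_type, Fin.sum_univ_four]; ring
  · refine main ![y 3, y 2, -y 1, -y 0] ?_ ?_ ?_
    · simp [Fin.sum_univ_four]; ring
    · simp [Fin.sum_univ_four]; ring
    · simp [h2c, ydyVec, tens, Fintype.sum_prod_type, Fin.sum_univ_four, Prod.ext_iff]; ring
  · refine main ![y 1, y 0, -y 3, -y 2] ?_ ?_ ?_
    · simp [Fin.sum_univ_four]; ring
    · simp [Fin.sum_univ_four]; ring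
    · simp [h2c, ydyVec, tens, Fintype.sum_prod_type, Fin.sum_univ_four, Prod.ext_iff]; ring

open scoped MatrixOrder Matrix.Norms.L2Operator in
lemma aux_psd (Q : Matrix (Fin 4) (Fin 4) ℂ) (h : Q.PosSemidef) :
    ∃ x : Fin 4 → Fin 4 → ℂ, Q = ∑ m, proj (x m) := by
  obtain ⟨B, rfl⟩ := CStarAlgebra.nonneg_iff_eq_star_mul_self.1 h.nonneg
  refine ⟨fun m i => star (B m i), ?_⟩
  ext i j
  simp [mul_apply, Matrix.sum_apply, proj, vecMulVec_apply, star_eq_conjTranspose]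

lemma aux_kron (x y : Fin 4 → ℂ) : proj x ⊗ₖ proj y = proj (tens x y) := by
  ext ⟨a, b⟩ ⟨c, d⟩
  simp [proj, tens, vecMulVec_apply]
  ring

lemma aux_sep (k : Fin 4) (P : Matrix (Fin 4 × Fin 4) (Fin 4 × Fin 4) ℂ) (h : SepMat P) :
    ((proj (ydyVec k) * P).trace).re + ((ptFst (proj auxPsi) * P).trace).re
      ≤ 1 / 4 * (P.trace).re := by
  obtain ⟨M, Q, R, hQ, hR, rfl⟩ := h
  simp only [Matrix.mul_sum, trace_sum, re_sum, Finset.mul_sum, ← Finset.sum_add_distrib]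
  refine Finset.sum_le_sum fun j _ => ?_
  obtain ⟨x, hx⟩ := aux_psd _ (hQ j)
  obtain ⟨y, hy⟩ := aux_psd _ (hR j)
  have : Q j ⊗ₖ R j = ∑ m, ∑ n, proj (tens (x m) (y n)) := by
    rw [hx, hy]
    simp only [← aux_kron]
    ext ⟨a, b⟩ ⟨c, d⟩
    simp [Matrix.sum_apply, Finset.sum_mul_sum]
  rw [this]
  simp only [Matrix.mul_sum, trace_sum, re_sum, Finset.mul_sum, ← Finset.sum_add_distrib]
  exact Finset.sum_le_sum fun m _ => Finset.sum_le_sum fun n _ => aux_core k _ _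

/-- The success probability of any separable measurement at discriminating the four
Yu–Duan–Ying states (uniform prior) is at most `3/4`. -/
theorem ydy_sep_bound
    (P : Fin 4 → Matrix (Fin 4 × Fin 4) (Fin 4 × Fin 4) ℂ)
    (hsep : ∀ k, SepMat (P k)) (hsum : ∑ k, P k = 1) :
    (1 / 4 : ℝ) * ∑ k : Fin 4, ((proj (ydyVec k) * P k).trace).re ≤ 3 / 4 := by
  have h := Finset.sum_le_sum fun k (_ : k ∈ Finset.univ) => aux_sep k (P k) (hsep k)
  rw [Finset.sum_add_distrib, ← Finset.mul_sum] at h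
  have h1 : ∑ k, ((P k).trace).re = 16 := by
    rw [← re_sum, ← trace_sum, hsum, trace_one]; simp
  have h2 : ∑ k, ((ptFst (proj auxPsi) * P k).trace).re = 1 := by
    rw [← re_sum, ← trace_sum, ← Matrix.mul_sum, hsum, mul_one]
    simp [trace, ptFst, proj, vecMulVec_apply, auxPsi, Fintype.sum_prod_type, Fin.sum_univ_four,
      Prod.ext_iff]
    norm_num
  rw [h1, h2] at h
  linarith
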